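/- arXiv:2106.01442 — 3 statements merged into one kernel-verified Lean document; each statement's English description precedes it below -/
import Mathlib

section
/- Let x_* ∈ X be a solution of the Minty variational inequality, i.e. ⟨g(x), x_* − x⟩ ≤ 0 for all x ∈ X. Let N ≥ 1, let L_1, …, L_N be reals with 0 < L_k ≤ 2L for some L > 0, and let z_0, …, z_N ∈ X and w_0, …, w_{N−1} ∈ X be points such that for every k ∈ {0, …, N−1} and every u ∈ X one has ⟨g(w_k), w_k − u⟩ ≤ L_{k+1}(V(u, z_k) − V(u, z_{k+1})). Then, with S_N = Σ_{k=0}^{N−1} 1/L_{k+1}, the following holds: −(1/S_N) Σ_{k=0}^{N−1} ⟨g(w_k), x_* − w_k⟩ / L_{k+1} ≤ V(x_*, z_0)/S_N ≤ 2L·V(x_*, z_0)/N. -/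
open RealInnerProductSpace Finset

/-- Key estimate of Theorem 1 (convergence of the Universal Mirror Prox method). -/
theorem ump_convergence_estimate
    {E : Type*} [NormedAddCommGroup E] [InnerProductSpace ℝ E]
    [FiniteDimensional ℝ E]
    (X : Set E) (hXne : X.Nonempty) (hXcompact : IsCompact X) (hXconvex : Convex ℝ X)
    (g : E → E) (V : E → E → ℝ)
    (hVnonneg : ∀ x ∈ X, ∀ y ∈ X, 0 ≤ V y x)
    (xs : E) (hxs : xs ∈ X)
    (hMinty : ∀ x ∈ X, ⟪g x, xs - x⟫ ≤ 0)
    (N : ℕ) (hN : 1 ≤ N)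
    (L : ℝ) (hL : 0 < L)
    (Lk : ℕ → ℝ)
    (hLk : ∀ k < N, 0 < Lk (k + 1) ∧ Lk (k + 1) ≤ 2 * L)
    (z : ℕ → E) (hz : ∀ k ≤ N, z k ∈ X)
    (w : ℕ → E) (hw : ∀ k < N, w k ∈ X)
    (hstep : ∀ k < N, ∀ u ∈ X,
      ⟪g (w k), w k - u⟫ ≤ Lk (k + 1) * (V u (z k) - V u (z (k + 1))))
    (SN : ℝ) (hSN : SN = ∑ k ∈ range N, 1 / Lk (k + 1)) :
    -(1 / SN) * ∑ k ∈ range N, ⟪g (w k), xs - w k⟫ / Lk (k + 1)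
        ≤ V xs (z 0) / SN ∧
      V xs (z 0) / SN ≤ 2 * L * V xs (z 0) / N := by
  have hN0 : (0 : ℝ) < N := by exact_mod_cast hN
  have hV0 : 0 ≤ V xs (z 0) := hVnonneg _ (hz 0 (Nat.zero_le N)) _ hxs
  have hVN : 0 ≤ V xs (z N) := hVnonneg _ (hz N le_rfl) _ hxs
  have hSN_lower : (N : ℝ) / (2 * L) ≤ SN := by
    have h : ∑ _k ∈ range N, 1 / (2 * L) ≤ ∑ k ∈ range N, 1 / Lk (k + 1) :=
      sum_le_sum fun k hk =>
        one_div_le_one_div_of_le (hLk k (mem_range.mp hk)).1 (hLk k (mem_range.mp hk)).2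
    rw [sum_const, card_range, nsmul_eq_mul, mul_one_div] at h
    exact hSN ▸ h
  have hSN_pos : 0 < SN := lt_of_lt_of_le (by positivity) hSN_lower
  have hsum : ∑ k ∈ range N, -(⟪g (w k), xs - w k⟫ / Lk (k + 1)) ≤ V xs (z 0) - V xs (z N) := by
    rw [← sum_range_sub' fun k => V xs (z k)]
    refine sum_le_sum fun k hk => ?_
    have hk' := mem_range.mp hk
    rw [← neg_div, ← inner_neg_right, neg_sub, div_le_iff₀' (hLk k hk').1]
    exact hstep k hk' xs hxs
  rw [sum_neg_distrib] at hsum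
  constructor
  · rw [neg_mul, one_div_mul_eq_div, ← neg_div]
    gcongr
    linarith
  · calc V xs (z 0) / SN ≤ V xs (z 0) / (N / (2 * L)) := by gcongr
      _ = 2 * L * V xs (z 0) / N := by field_simp
end

section
/- (Lemma 1, δ-decreasing of the Bregman divergence.) Let δ ≥ 0. Suppose x_* ∈ X satisfies ⟨g_δ(x_*), x − x_*⟩ ≥ 0 for all x ∈ X, and that g_δ is monotone: ⟨g_δ(x) − g_δ(y), x − y⟩ ≥ 0 for all x, y ∈ X. Let z_0, …, z_N ∈ X, w_0, …, w_{N−1} ∈ X and positive reals L_1, …, L_N satisfy, for every k ∈ {0, …, N−1}, the per-iteration inequality −⟨g_δ(w_k), x_* − w_k⟩ ≤ L_{k+1}(V(x_*, z_k) − V(x_*, z_{k+1})) + δ. Then V(x_*, z_N) ≤ V(x_*, z_0) + δ·S_N, where S_N = Σ_{k=0}^{N−1} 1/L_{k+1}. -/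
open RealInnerProductSpace Finset

/-- Lemma 1: δ-decreasing of the Bregman divergence along the
Universal Mirror Prox iterates. -/
theorem bregman_delta_decrease
    {E : Type*} [NormedAddCommGroup E] [InnerProductSpace ℝ E]
    [FiniteDimensional ℝ E]
    (X : Set E) (hXne : X.Nonempty) (hXcompact : IsCompact X) (hXconvex : Convex ℝ X)
    (gδ : E → E) (V : E → E → ℝ)
    (δ : ℝ) (hδ : 0 ≤ δ)
    (xs : E) (hxs : xs ∈ X)
    (hsol : ∀ x ∈ X, 0 ≤ ⟪gδ xs, x - xs⟫)
    (hmono : ∀ x ∈ X, ∀ y ∈ X, 0 ≤ ⟪gδ x - gδ y, x - y⟫)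
    (N : ℕ)
    (z : ℕ → E) (hz : ∀ k ≤ N, z k ∈ X)
    (w : ℕ → E) (hw : ∀ k < N, w k ∈ X)
    (Lk : ℕ → ℝ) (hLk : ∀ k < N, 0 < Lk (k + 1))
    (hstep : ∀ k < N,
      -⟪gδ (w k), xs - w k⟫ ≤ Lk (k + 1) * (V xs (z k) - V xs (z (k + 1))) + δ)
    (SN : ℝ) (hSN : SN = ∑ k ∈ range N, 1 / Lk (k + 1)) :
    V xs (z N) ≤ V xs (z 0) + δ * SN := by
  have step : ∀ k < N, V xs (z (k + 1)) ≤ V xs (z k) + δ * (1 / Lk (k + 1)) := by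
    intro k hk
    have hL := hLk k hk
    have hw_nonneg : 0 ≤ -⟪gδ (w k), xs - w k⟫ := by
      have h₁ := hsol (w k) (hw k hk)
      have h₂ := hmono (w k) (hw k hk) xs hxs
      rw [inner_sub_left] at h₂
      rw [← inner_neg_right, neg_sub]
      linarith
    have h := hw_nonneg.trans (hstep k hk)
    have hdiv : V xs (z (k + 1)) - V xs (z k) ≤ δ / Lk (k + 1) := by
      rw [le_div_iff₀ hL]
      linarith
    rw [mul_one_div]
    linarith
  have partial_sum : ∀ n ≤ N,
      V xs (z n) ≤ V xs (z 0) + δ * ∑ k ∈ range n, 1 / Lk (k + 1) := by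
    intro n
    induction n with
    | zero => simp
    | succ n ih =>
      intro hn
      have h₁ := ih (by omega)
      have h₂ := step n (by omega)
      rw [sum_range_succ, mul_add]
      linarith
  rw [hSN]
  exact partial_sum N le_rfl
end

section
/- Let δ ≥ 0, μ > 0, Ω > 0, L ≥ μ and R > 0. Suppose g_δ is relatively strongly monotone with parameter μ: ⟨g_δ(y), x − y⟩ + ⟨g_δ(x), y − x⟩ + μ V(x,y) ≤ δ for all x, y ∈ X. Suppose x_* ∈ X satisfies ⟨g_δ(x_*), x − x_*⟩ ≥ −δ for all x ∈ X. Let w_0, …, w_{N−1} ∈ X and positive reals L_1, …, L_N with L_k ≥ μ be such that: (a) V(x_*, w_{k+1}) ≤ V(x_*, w_k) + δ/μ for all k ≤ N − 2, and (b) −(1/S_N) Σ_{k=0}^{N−1} ⟨g_δ(w_k), x_* − w_k⟩ / L_{k+1} ≤ Ω R² / (2 S_N) − δ, where S_N = Σ_{k=0}^{N−1} 1/L_{k+1}. Then V(x_*, w_{N−1}) ≤ Ω R² / (2 μ S_N) + (1 + N) δ / μ. In particular, if additionally N ≤ 2ΩL/μ, then V(x_*, w_{N−1}) ≤ Ω R²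 / (2 μ S_N) + (δ/μ)(1 + 2ΩL/μ). -/
open RealInnerProductSpace Finset

/-- A real sequence whose increments are at most `c` on an initial segment grows at most
linearly there. -/
theorem le_add_mul_of_succ_le_add {f : ℕ → ℝ} {c : ℝ} {N : ℕ}
    (h : ∀ k, k + 1 < N → f (k + 1) ≤ f k + c) (k j : ℕ) (hkj : k + j < N) :
    f (k + j) ≤ f k + j * c := by
  induction j with
  | zero => simp
  | succ j ih =>
    have h₁ := ih (by omega)
    have h₂ := h (k + j) (by omega)
    rw [← add_assoc]
    push_cast
    linarith

/-- Per-restart estimate in the proof of Theorem 2 for the Restarted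
Universal Mirror Prox method. -/
theorem per_restart_estimate
    {E : Type*} [NormedAddCommGroup E] [InnerProductSpace ℝ E]
    [FiniteDimensional ℝ E]
    (X : Set E) (hXne : X.Nonempty) (hXcompact : IsCompact X) (hXconvex : Convex ℝ X)
    (gδ : E → E) (V : E → E → ℝ)
    (δ μ Ω L R : ℝ)
    (hδ : 0 ≤ δ) (hμ : 0 < μ) (hΩ : 0 < Ω) (hLμ : μ ≤ L) (hR : 0 < R)
    (hrsm : ∀ x ∈ X, ∀ y ∈ X,
      ⟪gδ y, x - y⟫ + ⟪gδ x, y - x⟫ + μ * V x y ≤ δ)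
    (xs : E) (hxs : xs ∈ X)
    (hsol : ∀ x ∈ X, -δ ≤ ⟪gδ xs, x - xs⟫)
    (N : ℕ) (hN : 1 ≤ N)
    (w : ℕ → E) (hw : ∀ k < N, w k ∈ X)
    (Lk : ℕ → ℝ) (hLkpos : ∀ k < N, 0 < Lk (k + 1)) (hLkμ : ∀ k < N, μ ≤ Lk (k + 1))
    (SN : ℝ) (hSN : SN = ∑ k ∈ range N, 1 / Lk (k + 1))
    (hdec : ∀ k, k + 1 < N → V xs (w (k + 1)) ≤ V xs (w k) + δ / μ)
    (havg : -(1 / SN) * ∑ k ∈ range N, ⟪gδ (w k), xs - w k⟫ / Lk (k + 1)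
      ≤ Ω * R ^ 2 / (2 * SN) - δ) :
    V xs (w (N - 1)) ≤ Ω * R ^ 2 / (2 * μ * SN) + (1 + N) * δ / μ ∧
      ((N : ℝ) ≤ 2 * Ω * L / μ →
        V xs (w (N - 1)) ≤ Ω * R ^ 2 / (2 * μ * SN) + (δ / μ) * (1 + 2 * Ω * L / μ)) := by
  have hSpos : 0 < SN := by
    rw [hSN]
    exact sum_pos (fun k hk => one_div_pos.2 (hLkpos k (mem_range.1 hk)))
      (nonempty_range_iff.2 (by omega))
  have hc : 0 ≤ δ / μ := div_nonneg hδ hμ.le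
  have hgap : ∀ k < N, μ * V xs (w (N - 1)) - 2 * δ - N * δ ≤ -⟪gδ (w k), xs - w k⟫ := by
    intro k hk
    have h₁ := hrsm xs hxs (w k) (hw k hk)
    have h₂ := hsol (w k) (hw k hk)
    have h₃ := le_add_mul_of_succ_le_add (f := fun k => V xs (w k)) hdec k (N - 1 - k)
      (by omega)
    simp only [show k + (N - 1 - k) = N - 1 by omega] at h₃
    have h₄ : ((N - 1 - k : ℕ) : ℝ) * (δ / μ) ≤ N * (δ / μ) :=
      mul_le_mul_of_nonneg_right (by exact_mod_cast (by omega : N - 1 - k ≤ N)) hc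
    have h₅ : μ * V xs (w (N - 1)) ≤ μ * (V xs (w k) + N * (δ / μ)) :=
      mul_le_mul_of_nonneg_left (by linarith) hμ.le
    have h₆ : μ * (V xs (w k) + N * (δ / μ)) = μ * V xs (w k) + N * δ := by
      field_simp
    linarith
  have hsum : (μ * V xs (w (N - 1)) - 2 * δ - N * δ) * SN
      ≤ -∑ k ∈ range N, ⟪gδ (w k), xs - w k⟫ / Lk (k + 1) := by
    rw [hSN, mul_sum, ← sum_neg_distrib]
    refine sum_le_sum fun k hk => ?_
    rw [mul_one_div, ← neg_div]
    exact div_le_div_of_nonneg_right (hgap k (mem_range.1 hk)) (hLkpos k (mem_range.1 hk)).le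
  have hmul : μ * V xs (w (N - 1)) ≤ Ω * R ^ 2 / (2 * SN) + (1 + N) * δ := by
    have h := (le_div_iff₀ hSpos).2 hsum
    have heq : -(1 / SN) * ∑ k ∈ range N, ⟪gδ (w k), xs - w k⟫ / Lk (k + 1)
        = (-∑ k ∈ range N, ⟪gδ (w k), xs - w k⟫ / Lk (k + 1)) / SN := by ring
    linarith
  have hmain : V xs (w (N - 1)) ≤ Ω * R ^ 2 / (2 * μ * SN) + (1 + N) * δ / μ := by
    have heq : Ω * R ^ 2 / (2 * μ * SN) + (1 + N) * δ / μ
        = (Ω * R ^ 2 / (2 * SN) + (1 + N) * δ) / μ := by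
      field_simp
    rw [heq, le_div_iff₀ hμ]
    linarith
  refine ⟨hmain, fun hNle => hmain.trans ?_⟩
  have h := mul_le_mul_of_nonneg_left hNle hc
  have heq : (1 + N) * δ / μ = δ / μ + δ / μ * N := by ring
  linarith
end
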